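/- Let 𝓕 be a stable and saturated family of 3-element subsets of [13] with ν(𝓕) = 3 and ν(𝓕(1̄)) = 3. Then |𝓕| ≤ C(11,3) = 165. -/

import Mathlib

/-- The matching number of a family of finite sets: the maximum number of
pairwise disjoint nonempty members. -/
noncomputable def matchNum (𝓕 : Finset (Finset ℕ)) : ℕ :=
  sSup {m | ∃ M ⊆ 𝓕, M.card = m ∧ (∀ A ∈ M, A.Nonempty) ∧
    (M : Set (Finset ℕ)).Pairwise fun A B => Disjoint A B}

/-- A family of subsets of `[n] = {1,…,n}` is stable if it is closed downwards
under the "shifting" partial order: whenever `F ∈ 𝓕` and `G ⊆ [n]` admits a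
bijection `φ : F → G` with `φ x ≤ x` for all `x ∈ F`, then `G ∈ 𝓕`. -/
def Stable (n : ℕ) (𝓕 : Finset (Finset ℕ)) : Prop :=
  ∀ F ∈ 𝓕, ∀ G : Finset ℕ, G ⊆ Finset.Icc 1 n → G.card = F.card →
    (∃ φ : ℕ → ℕ, Set.BijOn φ (F : Set ℕ) (G : Set ℕ) ∧ ∀ x ∈ F, φ x ≤ x) → G ∈ 𝓕

/-- A family of `k`-element subsets of `[n]` is saturated if adding any new
`k`-element subset of `[n]` increases the matching number. -/
def Saturated (n k : ℕ) (𝓕 : Finset (Finset ℕ)) : Prop :=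
  ∀ E : Finset ℕ, E ⊆ Finset.Icc 1 n → E.card = k → E ∉ 𝓕 →
    matchNum 𝓕 < matchNum (insert E 𝓕)

open Finset

/-- The set of entries of a triple. -/
def tripleSet (t : ℕ × ℕ × ℕ) : Finset ℕ := {t.1, t.2.1, t.2.2}

/-- A triple of positive integers in increasing order. -/
abbrev IsIncreasing (t : ℕ × ℕ × ℕ) : Prop := 1 ≤ t.1 ∧ t.1 < t.2.1 ∧ t.2.1 < t.2.2

lemma exists_triple_of_card_eq_three {s : Finset ℕ} (h : s.card = 3) :
    ∃ t : ℕ × ℕ × ℕ, t.1 < t.2.1 ∧ t.2.1 < t.2.2 ∧ tripleSet t = s := by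
  have hlt (i j : Fin 3) (hij : i < j) : s.orderEmbOfFin h i < s.orderEmbOfFin h j := by
    simpa using hij
  refine ⟨(s.orderEmbOfFin h 0, s.orderEmbOfFin h 1, s.orderEmbOfFin h 2),
    hlt 0 1 (by decide), hlt 1 2 (by decide), ?_⟩
  ext x
  have := congrArg (x ∈ ·) (s.range_orderEmbOfFin h)
  simp only [Set.mem_range, Fin.exists_fin_succ, Finset.mem_coe] at this
  rw [← this]
  simp [tripleSet, eq_comm]

lemma bddAbove_matching_card (𝓕 : Finset (Finset ℕ)) :
    BddAbove {m | ∃ M ⊆ 𝓕, M.card = m ∧ (∀ A ∈ M, A.Nonempty) ∧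
      (M : Set (Finset ℕ)).Pairwise fun A B => Disjoint A B} :=
  ⟨𝓕.card, by rintro m ⟨M, hM, rfl, -⟩; exact card_le_card hM⟩

lemma card_le_matchNum {𝓕 M : Finset (Finset ℕ)} (hM : M ⊆ 𝓕) (hne : ∀ A ∈ M, A.Nonempty)
    (hd : (M : Set (Finset ℕ)).Pairwise fun A B => Disjoint A B) : M.card ≤ matchNum 𝓕 :=
  le_csSup (bddAbove_matching_card 𝓕) ⟨M, hM, rfl, hne, hd⟩

lemma exists_matching_card_eq_matchNum (𝓕 : Finset (Finset ℕ)) :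
    ∃ M ⊆ 𝓕, M.card = matchNum 𝓕 ∧ (∀ A ∈ M, A.Nonempty) ∧
      (M : Set (Finset ℕ)).Pairwise fun A B => Disjoint A B :=
  Nat.sSup_mem (s := {m | ∃ M ⊆ 𝓕, M.card = m ∧ (∀ A ∈ M, A.Nonempty) ∧
      (M : Set (Finset ℕ)).Pairwise fun A B => Disjoint A B})
    ⟨0, ∅, by simp⟩ (bddAbove_matching_card 𝓕)

lemma Stable.tripleSet_mem {n : ℕ} {𝓕 : Finset (Finset ℕ)} (hst : Stable n 𝓕)
    (h𝓕 : 𝓕 ⊆ powersetCard 3 (Icc 1 n)) {t u : ℕ × ℕ × ℕ} (hu : IsIncreasing u)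
    (ht : t.1 < t.2.1 ∧ t.2.1 < t.2.2) (hut : u ≤ t) (hmem : tripleSet t ∈ 𝓕) :
    tripleSet u ∈ 𝓕 := by
  obtain ⟨a, b, c⟩ := t
  obtain ⟨x, y, z⟩ := u
  simp only [IsIncreasing, Prod.mk_le_mk] at hu ht hut
  have hc : c ≤ n := by
    have := (mem_powersetCard.1 (h𝓕 hmem)).1 (show c ∈ tripleSet (a, b, c) by simp [tripleSet])
    exact (mem_Icc.1 this).2
  have hcard {p q r : ℕ} (h₁ : p < q) (h₂ : q < r) : (tripleSet (p, q, r)).card = 3 :=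
    card_eq_three.2 ⟨p, q, r, by omega, by omega, by omega, rfl⟩
  refine hst _ hmem _ ?_ (by rw [hcard hu.2.1 hu.2.2, hcard ht.1 ht.2])
    ⟨fun m => if m = a then x else if m = b then y else z, ⟨?_, ?_, ?_⟩, ?_⟩
  · intro m hm
    simp only [tripleSet, mem_insert, mem_singleton, mem_Icc] at hm ⊢
    omega
  · intro m hm
    simp only [tripleSet, coe_insert, coe_singleton, Set.mem_insert_iff,
      Set.mem_singleton_iff] at hm ⊢
    grind
  · intro m hm k hk hmk
    simp only [tripleSet, coe_insert, coe_singleton, Set.mem_insert_iff,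
      Set.mem_singleton_iff] at hm hk hmk
    grind
  · intro m hm
    simp only [tripleSet, coe_insert, coe_singleton, Set.mem_insert_iff,
      Set.mem_singleton_iff, Set.mem_image] at hm ⊢
    rcases hm with rfl | rfl | rfl
    · exact ⟨a, by simp, by simp⟩
    · exact ⟨b, by simp, by grind⟩
    · exact ⟨c, by simp, by grind⟩
  · intro m hm
    simp only [tripleSet, mem_insert, mem_singleton] at hm
    grind

/-- A disjoint triple can be added to a matching. -/
lemma not_mem_of_disjoint_matching {𝓕 M : Finset (Finset ℕ)} {A : Finset ℕ} (hM : M ⊆ 𝓕)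
    (hne : ∀ B ∈ M, B.Nonempty) (hd : (M : Set (Finset ℕ)).Pairwise fun A B => Disjoint A B)
    (hcard : matchNum 𝓕 ≤ M.card) (hA : A.Nonempty) (hAM : ∀ B ∈ M, Disjoint A B) : A ∉ 𝓕 := by
  intro hmem
  have hAn : A ∉ M := fun h => hA.ne_empty (disjoint_self.1 (hAM A h))
  have := card_le_matchNum (insert_subset hmem hM) (by simpa [hA] using hne) (by
    rw [coe_insert]
    exact hd.insert fun B hB _ => ⟨hAM B hB, (hAM B hB).symm⟩)
  rw [card_insert_of_notMem hAn] at this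
  omega

/-- If pairwise disjoint triples `uᵢ` lie below triples `tᵢ`, then a stable family with matching
number three cannot contain all four `tᵢ`. -/
lemma Stable.not_mem_of_four_le {𝓕 : Finset (Finset ℕ)} {n : ℕ} (hst : Stable n 𝓕)
    (h𝓕 : 𝓕 ⊆ powersetCard 3 (Icc 1 n)) (hν : matchNum 𝓕 = 3) {t₁ t₂ t₃ t₄ : ℕ × ℕ × ℕ}
    (h₁ : tripleSet t₁ ∈ 𝓕) (h₂ : tripleSet t₂ ∈ 𝓕) (h₃ : tripleSet t₃ ∈ 𝓕)
    (u₁ u₂ u₃ u₄ : ℕ × ℕ × ℕ)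
    (hu : ∀ p ∈ [(u₁, t₁), (u₂, t₂), (u₃, t₃), (u₄, t₄)],
      IsIncreasing p.1 ∧ (p.2.1 < p.2.2.1 ∧ p.2.2.1 < p.2.2.2) ∧
        p.1.1 ≤ p.2.1 ∧ p.1.2.1 ≤ p.2.2.1 ∧ p.1.2.2 ≤ p.2.2.2)
    (hd : [u₁, u₂, u₃, u₄].Pairwise fun u v => Disjoint (tripleSet u) (tripleSet v)) :
    tripleSet t₄ ∉ 𝓕 := by
  intro h₄
  have hne (u) : (tripleSet u).Nonempty := ⟨u.1, by simp [tripleSet]⟩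
  simp only [List.mem_cons, List.not_mem_nil, or_false, forall_eq_or_imp, forall_eq] at hu
  have hmem {u t : ℕ × ℕ × ℕ} (h : IsIncreasing u ∧ (t.1 < t.2.1 ∧ t.2.1 < t.2.2) ∧
      u.1 ≤ t.1 ∧ u.2.1 ≤ t.2.1 ∧ u.2.2 ≤ t.2.2) (ht : tripleSet t ∈ 𝓕) : tripleSet u ∈ 𝓕 :=
    hst.tripleSet_mem h𝓕 h.1 h.2.1 ⟨h.2.2.1, h.2.2.2.1, h.2.2.2.2⟩ ht
  simp only [List.pairwise_cons, List.mem_cons, List.not_mem_nil, or_false, forall_eq_or_imp,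
    forall_eq] at hd
  obtain ⟨⟨d₁₂, d₁₃, d₁₄⟩, ⟨d₂₃, d₂₄⟩, d₃₄, -⟩ := hd
  have hne₁₂ := d₁₂.ne (hne u₁).ne_empty
  have hne₁₃ := d₁₃.ne (hne u₁).ne_empty
  have hne₂₃ := d₂₃.ne (hne u₂).ne_empty
  refine not_mem_of_disjoint_matching (M := {tripleSet u₁, tripleSet u₂, tripleSet u₃})
    (A := tripleSet u₄) ?_ ?_ ?_ ?_ (hne _) ?_ (hmem hu.2.2.2 h₄)
  · simp [insert_subset_iff, hmem hu.1 h₁, hmem hu.2.1 h₂, hmem hu.2.2.1 h₃]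
  · simp [hne]
  · simp [Set.pairwise_insert, d₁₂, d₁₃, d₂₃, d₁₂.symm, d₁₃.symm, d₂₃.symm]
  · rw [hν, card_eq_three.2 ⟨_, _, _, hne₁₂, hne₁₃, hne₂₃, rfl⟩]
  · simp [d₁₄.symm, d₂₄.symm, d₃₄.symm]

/-- A matching of three triples avoiding `1` forbids `{1, 11, 12}`. -/
lemma Stable.one_eleven_twelve_not_mem {𝓕 : Finset (Finset ℕ)}
    (h𝓕 : 𝓕 ⊆ powersetCard 3 (Icc 1 13)) (hst : Stable 13 𝓕) (hν : matchNum 𝓕 = 3)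
    (hν1 : matchNum (𝓕.filter fun F => 1 ∉ F) = 3) : tripleSet (1, 11, 12) ∉ 𝓕 := by
  intro hmem
  obtain ⟨M, hM, hcard, hne, hd⟩ := exists_matching_card_eq_matchNum (𝓕.filter fun F => 1 ∉ F)
  have hU : (M.biUnion id).card ≤ 9 := by
    refine (card_biUnion_le_card_mul M id 3 fun A hA => ?_).trans (by omega)
    exact (mem_powersetCard.1 (h𝓕 (mem_filter.1 (hM hA)).1)).2.le
  have hW : 3 ≤ (Icc 2 13 \ M.biUnion id).card := by
    have := le_card_sdiff (M.biUnion id) (Icc 2 13)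
    simp only [Nat.card_Icc] at this
    omega
  obtain ⟨W, hWs, hW3⟩ := exists_subset_card_eq hW
  obtain ⟨⟨y, z, w⟩, hyz, hzw, rfl⟩ := exists_triple_of_card_eq_three hW3
  have hmemW (x) (hx : x ∈ tripleSet (y, z, w)) : (2 ≤ x ∧ x ≤ 13) ∧ ∀ A ∈ M, x ∉ A := by
    have := hWs hx
    simpa using this
  have hy := hmemW y (by simp [tripleSet])
  have hz := hmemW z (by simp [tripleSet])
  have hw := hmemW w (by simp [tripleSet])
  simp only at hyz hzw
  refine not_mem_of_disjoint_matching (A := tripleSet (1, y, z)) (hM.trans (filter_subset _ _))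
    hne hd (by omega) ⟨1, by simp [tripleSet]⟩ (fun B hB => ?_)
    (hst.tripleSet_mem h𝓕 ⟨by simp, by simp; omega, by simpa using hyz⟩ (by simp)
      ⟨by simp, by simp; omega, by simp; omega⟩ hmem)
  simp [tripleSet, hy.2 B hB, hz.2 B hB, (mem_filter.1 (hM hB)).2]

/-- The increasing triples in `[13]` lying above no member of `L`. -/
abbrev triplesAvoiding (L : List (ℕ × ℕ × ℕ)) : Finset (ℕ × ℕ × ℕ) :=
  (Icc 1 13 ×ˢ Icc 1 13 ×ˢ Icc 1 13).filter fun t => t.1 < t.2.1 ∧ t.2.1 < t.2.2 ∧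
    ∀ u ∈ L, ¬ (u.1 ≤ t.1 ∧ u.2.1 ≤ t.2.1 ∧ u.2.2 ≤ t.2.2)

lemma Stable.card_le_card_triplesAvoiding {𝓕 : Finset (Finset ℕ)}
    (hst : Stable 13 𝓕) (h𝓕 : 𝓕 ⊆ powersetCard 3 (Icc 1 13)) (L : List (ℕ × ℕ × ℕ))
    (hL : ∀ u ∈ L, IsIncreasing u) (hmem : ∀ u ∈ L, tripleSet u ∉ 𝓕) :
    𝓕.card ≤ (triplesAvoiding L).card := by
  refine (card_le_card (t := (triplesAvoiding L).image tripleSet) fun A hA => ?_).trans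
    card_image_le
  obtain ⟨hsub, hcard⟩ := mem_powersetCard.1 (h𝓕 hA)
  obtain ⟨⟨a, b, c⟩, hab, hbc, rfl⟩ := exists_triple_of_card_eq_three hcard
  refine mem_image_of_mem _ (mem_filter.2 ⟨?_, hab, hbc, fun u hu hle => ?_⟩)
  · simp only [mem_product]
    exact ⟨hsub (by simp [tripleSet]), hsub (by simp [tripleSet]), hsub (by simp [tripleSet])⟩
  · exact hmem u hu (hst.tripleSet_mem h𝓕 (hL u hu) ⟨hab, hbc⟩ ⟨hle.1, hle.2⟩ hA)

/-- A stable, saturated family of 3-subsets of `[13]` with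
`ν(𝓕) = ν(𝓕(1̄)) = 3` has at most `C(11,3) = 165` members. -/
theorem case_s_three (𝓕 : Finset (Finset ℕ))
    (h𝓕 : 𝓕 ⊆ Finset.powersetCard 3 (Finset.Icc 1 13))
    (hst : Stable 13 𝓕) (hsat : Saturated 13 3 𝓕) (hν : matchNum 𝓕 = 3)
    (hν1 : matchNum (𝓕.filter fun F => 1 ∉ F) = 3) :
    𝓕.card ≤ Nat.choose 11 3 := by
  have h1_11_12 := Stable.one_eleven_twelve_not_mem h𝓕 hst hν hν1
  have hno {t₁ t₂ t₃ t₄} :=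
    hst.not_mem_of_four_le h𝓕 hν (t₁ := t₁) (t₂ := t₂) (t₃ := t₃) (t₄ := t₄)
  have hbound L hL hmem (hcard : (triplesAvoiding L).card ≤ Nat.choose 11 3) :=
    (hst.card_le_card_triplesAvoiding h𝓕 L hL hmem).trans hcard
  by_cases h3_6_10 : tripleSet (3, 6, 10) ∈ 𝓕
  · by_cases h4_8_10 : tripleSet (4, 8, 10) ∈ 𝓕
    · by_cases h5_6_11 : tripleSet (5, 6, 11) ∈ 𝓕
      · have h1_2_12 : tripleSet (1, 2, 12) ∉ 𝓕 :=
          hno h4_8_10 h4_8_10 h5_6_11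
            (3, 7, 9) (4, 8, 10) (5, 6, 11) (1, 2, 12) (by decide) (by decide)
        exact hbound [(1, 2, 12)] (by decide) (by simp [*])
          (by decide +kernel)
      · by_cases h1_5_12 : tripleSet (1, 5, 12) ∈ 𝓕
        · have h2_6_11 : tripleSet (2, 6, 11) ∉ 𝓕 :=
            hno h4_8_10 h4_8_10 h1_5_12
              (3, 7, 9) (4, 8, 10) (1, 5, 12) (2, 6, 11) (by decide) (by decide)
          exact hbound [(2, 6, 11), (1, 11, 12)] (by decide) (by simp [*])
            (by decide +kernel)
        · exact hbound [(5, 6, 11), (1, 5, 12)] (by decide) (by simp [*])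
            (by decide +kernel)
    · by_cases h2_5_12 : tripleSet (2, 5, 12) ∈ 𝓕
      · by_cases h2_8_11 : tripleSet (2, 8, 11) ∈ 𝓕
        · by_cases h1_9_12 : tripleSet (1, 9, 12) ∈ 𝓕
          · have h4_5_7 : tripleSet (4, 5, 7) ∉ 𝓕 :=
              hno h3_6_10 h2_8_11 h1_9_12
                (3, 6, 10) (2, 8, 11) (1, 9, 12) (4, 5, 7) (by decide) (by decide)
            exact hbound [(4, 5, 7), (1, 11, 12)] (by decide) (by simp [*])
              (by decide +kernel)
          · have h4_7_9 : tripleSet (4, 7, 9) ∉ 𝓕 :=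
              hno h3_6_10 h2_5_12 h2_8_11
                (3, 6, 10) (1, 5, 12) (2, 8, 11) (4, 7, 9) (by decide) (by decide)
            have h4_5_12 : tripleSet (4, 5, 12) ∉ 𝓕 :=
              hno h3_6_10 h2_8_11 h2_8_11
                (3, 6, 9) (1, 7, 10) (2, 8, 11) (4, 5, 12) (by decide) (by decide)
            exact hbound [(4, 7, 9), (4, 5, 12), (1, 9, 12)] (by decide) (by simp [*])
              (by decide +kernel)
        · by_cases h4_7_9 : tripleSet (4, 7, 9) ∈ 𝓕
          · by_cases h3_7_11 : tripleSet (3, 7, 11) ∈ 𝓕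
            · have h4_8_9 : tripleSet (4, 8, 9) ∉ 𝓕 :=
                hno h3_6_10 h2_5_12 h3_7_11
                  (2, 6, 10) (1, 5, 12) (3, 7, 11) (4, 8, 9) (by decide) (by decide)
              have h1_8_10 : tripleSet (1, 8, 10) ∉ 𝓕 :=
                hno h2_5_12 h4_7_9 h3_7_11
                  (2, 5, 12) (4, 6, 9) (3, 7, 11) (1, 8, 10) (by decide) (by decide)
              exact hbound [(4, 8, 9), (1, 8, 10)] (by decide) (by simp [*])
                (by decide +kernel)
            · have h1_8_11 : tripleSet (1, 8, 11) ∉ 𝓕 :=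
                hno h3_6_10 h2_5_12 h4_7_9
                  (3, 6, 10) (2, 5, 12) (4, 7, 9) (1, 8, 11) (by decide) (by decide)
              exact hbound [(1, 8, 11), (4, 8, 10), (3, 7, 11)] (by decide) (by simp [*])
                (by decide +kernel)
          · exact hbound [(2, 8, 11), (4, 7, 9), (1, 11, 12)] (by decide) (by simp [*])
              (by decide +kernel)
      · exact hbound [(4, 8, 10), (2, 5, 12), (1, 11, 12)] (by decide) (by simp [*])
          (by decide +kernel)
  · exact hbound [(3, 6, 10), (1, 11, 12)] (by decide) (by simp [*])
      (by decide +kernel)
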